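/- Let ε > 0, C > 0, and let (uₙ)_{n∈ℕ} be a sequence of continuous radial functions uₙ : ℝ³ → ℝ (each uₙ(x) depending only on |x|) with sup_{x∈ℝ³} |uₙ(x)|/(1+|x|) ≤ C for every n. Define T_ε(uₙ)(x) := −(1/(8π)) ∫_{ℝ³} |x−y| e^{−ε|y|²} e^{uₙ(y)} dy. Then there exist a subsequence (u_{n_k}) and a continuous function v : ℝ³ → ℝ with sup_x |v(x)|/(1+|x|) < ∞ such that sup_{x∈ℝ³} |T_ε(u_{n_k})(x) − v(x)|/(1+|x|) → 0 as k → ∞. (That is, the solution operator T_ε is compact on the Banach space of radial continuous functions with finite weighted sup norm ‖u‖ = sup_x |u(x)|/(1+|x|).) -/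

import Mathlib

open MeasureTheory
open Filter Topology

/-- Pointwise bounded families of `K`-Lipschitz functions are compact in the compact-open
topology. -/
theorem isCompact_setOf_lipschitzWith_of_abs_le {X : Type*} [PseudoMetricSpace X] (K : NNReal)
    (b : X → ℝ) : IsCompact {f : C(X, ℝ) | LipschitzWith K f ∧ ∀ x, |f x| ≤ b x} := by
  refine ArzelaAscoli.isCompact_of_equicontinuous _ ?_ ?_
  · have himage : Set.image ContinuousMap.toFun
        {f : C(X, ℝ) | LipschitzWith K f ∧ ∀ x, |f x| ≤ b x} =
          Set.univ.pi (fun x => Set.Icc (-b x) (b x)) ∩ {f | LipschitzWith K f} := by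
      ext f
      constructor
      · rintro ⟨g, ⟨hg, hb⟩, rfl⟩
        exact ⟨fun x _ => abs_le.1 (hb x), hg⟩
      · rintro ⟨hb, hf⟩
        exact ⟨⟨f, hf.continuous⟩, ⟨hf, fun x => abs_le.2 (hb x trivial)⟩, rfl⟩
    rw [himage]
    exact (isCompact_univ_pi fun x => isCompact_Icc).inter_right
      (isClosed_setOfPred_lipschitzWith K)
  · exact (LipschitzWith.uniformEquicontinuous _ K fun f => f.2.1).equicontinuous

/-- A sequence of uniformly Lipschitz functions staying within bounded distance of
`m n * ‖x‖`, with `m` bounded, has a subsequence converging in the weighted sup norm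
`sup |f x| / (1 + ‖x‖)`. -/
theorem exists_subseq_tendsto_weighted {E : Type*} [NormedAddCommGroup E] [ProperSpace E]
    (F : ℕ → E → ℝ) (m : ℕ → ℝ) (M : ℝ) (K : NNReal) (hF : ∀ n, LipschitzWith K (F n))
    (hm : ∀ n, |m n| ≤ M) (hFm : ∀ n x, |F n x - m n * ‖x‖| ≤ M) :
    ∃ φ : ℕ → ℕ, StrictMono φ ∧ ∃ v : E → ℝ, Continuous v ∧
      (∃ C' : ℝ, ∀ x, |v x| / (1 + ‖x‖) ≤ C') ∧
      ∀ δ : ℝ, 0 < δ → ∀ᶠ k in atTop, ∀ x, |F (φ k) x - v x| / (1 + ‖x‖) ≤ δ := by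
  have hbd : ∀ n x, |F n x| ≤ M * (1 + ‖x‖) := fun n x => by
    have h1 := abs_le.1 (hFm n x)
    have h2 := abs_le.1 (hm n)
    have h3 := norm_nonneg x
    rw [abs_le]
    constructor <;> nlinarith
  let f : ℕ → C(E, ℝ) := fun n => ⟨F n, (hF n).continuous⟩
  obtain ⟨⟨a, v⟩, hav, φ, hφ, hlim⟩ := ((isCompact_Icc (a := -M) (b := M)).prod
    (isCompact_setOf_lipschitzWith_of_abs_le (X := E) K fun x => M * (1 + ‖x‖))).tendsto_subseq
    (x := fun n => (m n, f n)) fun n => ⟨abs_le.1 (hm n), hF n, hbd n⟩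
  rw [nhds_prod_eq, tendsto_prod_iff'] at hlim
  obtain ⟨hma, hfv⟩ := hlim
  refine ⟨φ, hφ, v, v.continuous,
    ⟨M, fun x => (div_le_iff₀ (by positivity)).2 (hav.2.2 x)⟩, fun δ hδ => ?_⟩
  have hva : ∀ x, |v x - a * ‖x‖| ≤ M := fun x =>
    le_of_tendsto ((((continuous_eval_const x).tendsto v).comp hfv).sub
      (hma.mul_const ‖x‖)).abs (Eventually.of_forall fun k => hFm (φ k) x)
  have hloc := Metric.tendstoUniformlyOn_iff.1
    (ContinuousMap.tendsto_iff_forall_isCompact_tendstoUniformlyOn.1 hfv _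
      (isCompact_closedBall (0 : E) (4 * M / δ))) δ hδ
  filter_upwards [hloc, Metric.tendsto_nhds.1 hma (δ / 2) (half_pos hδ)] with k hk hmk x
  rw [div_le_iff₀ (by positivity)]
  have hx0 := norm_nonneg x
  rcases le_total ‖x‖ (4 * M / δ) with hx | hx
  · have h := hk x (by simpa using hx)
    rw [dist_comm, Real.dist_eq] at h
    exact h.le.trans (by nlinarith)
  · rw [div_le_iff₀ hδ] at hx
    rw [Real.dist_eq] at hmk
    have h1 := abs_le.1 (hFm (φ k) x)
    have h2 := abs_le.1 (hva x)
    have h3 := abs_lt.1 hmk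
    simp only [Function.comp_apply] at h3
    rw [abs_le]
    constructor <;> nlinarith

/-- The weight `(1 + ‖y‖) e^{-ε‖y‖²} e^{C(1+‖y‖)}` is integrable. -/
theorem integrable_one_add_norm_mul_gaussian_mul_exp {V : Type*} [NormedAddCommGroup V]
    [InnerProductSpace ℝ V] [FiniteDimensional ℝ V] [MeasurableSpace V] [BorelSpace V]
    {ε : ℝ} (hε : 0 < ε) (C : ℝ) :
    Integrable fun y : V =>
      (1 + ‖y‖) * (Real.exp (-ε * ‖y‖ ^ 2) * Real.exp (C * (1 + ‖y‖))) := by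
  have hgauss : Integrable fun y : V => Real.exp (-(ε / 2) * ‖y‖ ^ 2) := by
    have h := (GaussianFourier.integrable_cexp_neg_mul_sq_norm_add (V := V)
      (b := ((ε / 2 : ℝ) : ℂ)) (by simpa using hε) 0 0).re
    refine h.congr (Eventually.of_forall fun y => ?_)
    simp only [zero_mul, add_zero]
    rw [← Complex.ofReal_neg, ← Complex.ofReal_pow, ← Complex.ofReal_mul, ← Complex.ofReal_exp]
    exact Complex.ofReal_re _
  refine (hgauss.const_mul (Real.exp (C + (C + 1) ^ 2 / (2 * ε)))).mono'
    (by fun_prop) (Eventually.of_forall fun y => ?_)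
  rw [Real.norm_of_nonneg (by positivity)]
  have h1 : 1 + ‖y‖ ≤ Real.exp ‖y‖ := by linarith [Real.add_one_le_exp ‖y‖]
  refine (mul_le_mul_of_nonneg_right h1 (by positivity)).trans ?_
  rw [← Real.exp_add, ← Real.exp_add, ← Real.exp_add, Real.exp_le_exp]
  have h2 : (C + 1) * ‖y‖ ≤ (C + 1) ^ 2 / (2 * ε) + ε / 2 * ‖y‖ ^ 2 := by
    have : (C + 1) ^ 2 / (2 * ε) + ε / 2 * ‖y‖ ^ 2 - (C + 1) * ‖y‖ =
        (C + 1 - ε * ‖y‖) ^ 2 / (2 * ε) := by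
      field_simp
      ring
    have : 0 ≤ (C + 1 - ε * ‖y‖) ^ 2 / (2 * ε) := by positivity
    linarith
  linarith

/-- Potentials `c ∫ ‖x - y‖ w n y dy` of densities dominated by a weight with finite first moment
have a subsequence converging in the weighted sup norm. -/
theorem exists_subseq_tendsto_potential {V : Type*} [NormedAddCommGroup V] [ProperSpace V]
    [MeasurableSpace V] [BorelSpace V] {μ : Measure V} (c : ℝ)
    {W : V → ℝ} (hW : Integrable (fun y => (1 + ‖y‖) * W y) μ) (w : ℕ → V → ℝ)
    (hwm : ∀ n, AEStronglyMeasurable (w n) μ) (hwW : ∀ n y, |w n y| ≤ W y) :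
    ∃ φ : ℕ → ℕ, StrictMono φ ∧ ∃ v : V → ℝ, Continuous v ∧
      (∃ C' : ℝ, ∀ x, |v x| / (1 + ‖x‖) ≤ C') ∧
      ∀ δ : ℝ, 0 < δ → ∀ᶠ k in atTop, ∀ x,
        |c * (∫ y, ‖x - y‖ * w (φ k) y ∂μ) - v x| / (1 + ‖x‖) ≤ δ := by
  have hW0 : ∀ y, 0 ≤ W y := fun y => (abs_nonneg _).trans (hwW 0 y)
  have hle : ∀ n (g : V → ℝ) (A : ℝ), (∀ y, |g y| ≤ A * (1 + ‖y‖)) → ∀ y,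
      ‖g y * w n y‖ ≤ A * ((1 + ‖y‖) * W y) := fun n g A hg y => by
    rw [Real.norm_eq_abs, abs_mul, ← mul_assoc]
    exact mul_le_mul (hg y) (hwW n y) (abs_nonneg _) ((abs_nonneg _).trans (hg y))
  have hint : ∀ n (g : V → ℝ) (A : ℝ), Continuous g → (∀ y, |g y| ≤ A * (1 + ‖y‖)) →
      Integrable (fun y => g y * w n y) μ := fun n g A hgc hg =>
    (hW.const_mul A).mono' (hgc.aestronglyMeasurable.mul (hwm n))
      (Eventually.of_forall (hle n g A hg))
  set J := ∫ y, (1 + ‖y‖) * W y ∂μ with hJ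
  have hJ0 : 0 ≤ J := integral_nonneg fun y => mul_nonneg (by positivity) (hW0 y)
  have hbound : ∀ n (g : V → ℝ) (A : ℝ), (∀ y, |g y| ≤ A * (1 + ‖y‖)) →
      |c * ∫ y, g y * w n y ∂μ| ≤ |c| * J * A := fun n g A hg => by
    have h := norm_integral_le_of_norm_le (hW.const_mul A) (Eventually.of_forall (hle n g A hg))
    rw [integral_const_mul, ← hJ, Real.norm_eq_abs] at h
    rw [abs_mul, mul_assoc, mul_comm J]
    exact mul_le_mul_of_nonneg_left h (abs_nonneg c)
  have hone : ∀ y : V, |(1 : ℝ)| ≤ 1 * (1 + ‖y‖) := fun y => by simp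
  have hker : ∀ n x, Integrable (fun y => ‖x - y‖ * w n y) μ := fun n x =>
    hint n _ (1 + ‖x‖) (by fun_prop) fun y => by
      rw [abs_norm]
      nlinarith [norm_sub_le x y, norm_nonneg x, norm_nonneg y]
  refine exists_subseq_tendsto_weighted (fun n x => c * ∫ y, ‖x - y‖ * w n y ∂μ)
    (fun n => c * ∫ y, 1 * w n y ∂μ) (|c| * J) ⟨|c| * J, by positivity⟩ ?_ ?_ ?_
  · refine fun n => LipschitzWith.of_dist_le_mul fun x z => ?_
    rw [Real.dist_eq, ← mul_sub, ← integral_sub (hker n x) (hker n z)]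
    simp_rw [← sub_mul]
    refine hbound n _ _ fun y => ?_
    have h := abs_norm_sub_norm_le (x - y) (z - y)
    rw [sub_sub_sub_cancel_right, ← dist_eq_norm x z] at h
    nlinarith [dist_nonneg (x := x) (y := z), norm_nonneg y]
  · exact fun n => (hbound n _ 1 hone).trans_eq (mul_one _)
  · intro n x
    rw [mul_assoc, ← integral_mul_const, ← mul_sub,
      ← integral_sub (hker n x) ((hint n _ 1 continuous_const hone).mul_const _)]
    have heq : ∀ y, ‖x - y‖ * w n y - 1 * w n y * ‖x‖ = (‖x - y‖ - ‖x‖) * w n y :=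
      fun y => by ring
    simp_rw [heq]
    refine (hbound n _ 1 fun y => ?_).trans_eq (mul_one _)
    have h := abs_norm_sub_norm_le (x - y) x
    rw [sub_sub_cancel_left, norm_neg] at h
    linarith

/-- Compactness of the regularized solution operator `T_ε` on the space of radial continuous
functions with finite weighted sup norm `‖u‖ = sup_x |u(x)|/(1+|x|)`: for any sequence `uₙ` of
continuous radial functions with `|uₙ(x)| ≤ C(1+|x|)` uniformly in `n`, the sequence
`T_ε(uₙ)(x) = −(1/(8π)) ∫_{ℝ³} |x−y| e^{−ε|y|²} e^{uₙ(y)} dy` has a subsequence converging in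
the weighted sup norm to some continuous `v` with finite weighted norm. -/
theorem stmt16 (ε C : ℝ) (hε : 0 < ε) (hC : 0 < C)
    (u : ℕ → EuclideanSpace ℝ (Fin 3) → ℝ)
    (hcont : ∀ n, Continuous (u n))
    (hrad : ∀ n, ∀ x y : EuclideanSpace ℝ (Fin 3), ‖x‖ = ‖y‖ → u n x = u n y)
    (hbd : ∀ n, ∀ x : EuclideanSpace ℝ (Fin 3), |u n x| / (1 + ‖x‖) ≤ C) :
    ∃ φ : ℕ → ℕ, StrictMono φ ∧
      ∃ v : EuclideanSpace ℝ (Fin 3) → ℝ, Continuous v ∧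
        (∃ C' : ℝ, ∀ x : EuclideanSpace ℝ (Fin 3), |v x| / (1 + ‖x‖) ≤ C') ∧
        ∀ δ : ℝ, 0 < δ → ∀ᶠ k in Filter.atTop, ∀ x : EuclideanSpace ℝ (Fin 3),
          |(-(1 / (8 * Real.pi)) *
              ∫ y : EuclideanSpace ℝ (Fin 3),
                ‖x - y‖ * Real.exp (-ε * ‖y‖ ^ 2) * Real.exp (u (φ k) y)) - v x|
            / (1 + ‖x‖) ≤ δ := by
  have hle : ∀ n y, |Real.exp (-ε * ‖y‖ ^ 2) * Real.exp (u n y)| ≤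
      Real.exp (-ε * ‖y‖ ^ 2) * Real.exp (C * (1 + ‖y‖)) := fun n y => by
    rw [abs_of_nonneg (by positivity)]
    gcongr
    exact (le_abs_self _).trans ((div_le_iff₀ (by positivity)).1 (hbd n y))
  simpa only [mul_assoc] using exists_subseq_tendsto_potential (-(1 / (8 * Real.pi)))
    (integrable_one_add_norm_mul_gaussian_mul_exp hε C)
    (fun n y => Real.exp (-ε * ‖y‖ ^ 2) * Real.exp (u n y))
    (fun n => by
      have := hcont n
      exact (by fun_prop : Continuous _).aestronglyMeasurable) hle
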